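/- arXiv:2408.11504 — 4 statements merged into one kernel-verified Lean document; each statement's English description precedes it below -/
import Mathlib

section
/- For every payoff matrix A ∈ ℝ^{m×n} there exist p* ∈ ℝ^m, q* ∈ ℝ^n and v* ∈ ℝ such that p* ≥ 0, 1ᵀp* = 1 and (p*)ᵀA ≥ v*·1ᵀ (componentwise), and simultaneously q* ≥ 0, 1ᵀq* = 1 and A q* ≤ v*·1 (componentwise). -/
/-- For every payoff matrix `A ∈ ℝ^{m×n}` (m, n positive) there exist mixed
strategies `p*`, `q*` and a value `v*` such that `(p*, v*)` is feasible in
player 1's problem and `(q*, v*)` is feasible in player 2's problem. -/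
theorem minimax_feasible_pair (m n : ℕ) (hm : 0 < m) (hn : 0 < n)
    (A : Matrix (Fin m) (Fin n) ℝ) :
    ∃ (p : Fin m → ℝ) (q : Fin n → ℝ) (v : ℝ),
      (∀ i, 0 ≤ p i) ∧ (∑ i, p i = 1) ∧ (∀ j, v ≤ ∑ i, p i * A i j) ∧
      (∀ j, 0 ≤ q j) ∧ (∑ j, q j = 1) ∧ (∀ i, ∑ j, A i j * q j ≤ v) := by
  have : NeZero m := ⟨hm.ne'⟩
  have : NeZero n := ⟨hn.ne'⟩
  let f : (Fin m → ℝ) →ₗ[ℝ] (Fin n → ℝ) →ₗ[ℝ] ℝ := Matrix.toLinearMap₂' ℝ A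
  have hf (p : Fin m → ℝ) (q : Fin n → ℝ) : f p q = dotProduct p (A.mulVec q) :=
    Matrix.toLinearMap₂'_apply' A p q
  obtain ⟨q, hq, p, hp, hpq⟩ := Sion.exists_isSaddlePointOn
    (X := stdSimplex ℝ (Fin n)) (Y := stdSimplex ℝ (Fin m)) (f := fun q p ↦ f p q)
    ⟨_, single_mem_stdSimplex ℝ 0⟩ (convex_stdSimplex ℝ _) (isCompact_stdSimplex ℝ _)
    (fun p _ ↦ (f p).continuous_of_finiteDimensional.lowerSemicontinuous.lowerSemicontinuousOn _)
    (fun p _ ↦ ((f p).convexOn (convex_stdSimplex ℝ _)).quasiconvexOn)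
    (convex_stdSimplex ℝ _) ⟨_, single_mem_stdSimplex ℝ 0⟩ (isCompact_stdSimplex ℝ _)
    (fun q _ ↦
      (f.flip q).continuous_of_finiteDimensional.upperSemicontinuous.upperSemicontinuousOn _)
    (fun q _ ↦ ((f.flip q).concaveOn (convex_stdSimplex ℝ _)).quasiconcaveOn)
  refine ⟨p, q, f p q, hp.1, hp.2, fun j ↦ ?_, hq.1, hq.2, fun i ↦ ?_⟩
  · simpa [hf, dotProduct] using hpq _ (single_mem_stdSimplex ℝ j) p hp
  · have h : f (Pi.single i 1) q ≤ f p q := hpq q hq _ (single_mem_stdSimplex ℝ i)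
    rwa [hf (Pi.single i 1), single_one_dotProduct] at h
end

section
/- Von Neumann's minimax theorem: for every matrix A ∈ ℝ^{m×n}, the maximum over mixed strategies p of player 1 of the minimum over mixed strategies q of player 2 of the expected payoff pᵀAq, and the minimum over mixed strategies q of the maximum over mixed strategies p of pᵀAq, both exist (are attained) and are equal. -/
/-- The bilinear payoff of a matrix game has a saddle point on the product of the simplices of
mixed strategies. -/
theorem Matrix.exists_saddlePoint_stdSimplex {ι κ : Type*} [Fintype ι] [Fintype κ]
    [Nonempty ι] [Nonempty κ] (A : Matrix ι κ ℝ) :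
    ∃ p ∈ stdSimplex ℝ ι, ∃ q ∈ stdSimplex ℝ κ,
      ∀ p' ∈ stdSimplex ℝ ι, ∀ q' ∈ stdSimplex ℝ κ,
        ∑ i, ∑ j, p' i * A i j * q j ≤ ∑ i, ∑ j, p i * A i j * q' j := by
  classical
  let B : (ι → ℝ) →ₗ[ℝ] (κ → ℝ) →ₗ[ℝ] ℝ := Matrix.toLinearMap₂' ℝ A
  have hB (p : ι → ℝ) (q : κ → ℝ) : B p q = ∑ i, ∑ j, p i * A i j * q j := by
    simp only [B, Matrix.toLinearMap₂'_apply, smul_eq_mul]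
    exact Finset.sum_congr rfl fun i _ => Finset.sum_congr rfl fun j _ => by ring
  obtain ⟨q, hq, p, hp, h⟩ := Sion.exists_isSaddlePointOn (f := fun q p => B p q)
    ⟨_, single_mem_stdSimplex ℝ (Classical.arbitrary κ)⟩
    (convex_stdSimplex ℝ κ) (isCompact_stdSimplex ℝ κ)
    (fun p _ => (LinearMap.continuous_on_pi (B p)).lowerSemicontinuous.lowerSemicontinuousOn _)
    (fun p _ => ((B p).convexOn (convex_stdSimplex ℝ κ)).quasiconvexOn)
    (convex_stdSimplex ℝ ι) ⟨_, single_mem_stdSimplex ℝ (Classical.arbitrary ι)⟩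
    (isCompact_stdSimplex ℝ ι)
    (fun q _ =>
      (LinearMap.continuous_on_pi (B.flip q)).upperSemicontinuous.upperSemicontinuousOn _)
    (fun q _ => ((B.flip q).concaveOn (convex_stdSimplex ℝ ι)).quasiconcaveOn)
  refine ⟨p, hp, q, hq, fun p' hp' q' hq' => ?_⟩
  simpa only [hB] using h q' hq' p' hp'

/-- Von Neumann's minimax theorem: the max over p of the min over q of pᵀAq
and the min over q of the max over p of pᵀAq both exist (are attained) and
are equal. -/
theorem vonNeumann_minimax (m n : ℕ) (hm : 0 < m) (hn : 0 < n)
    (A : Matrix (Fin m) (Fin n) ℝ) :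
    ∃ v : ℝ,
      IsGreatest {x : ℝ | ∃ p : Fin m → ℝ, ((∀ i, 0 ≤ p i) ∧ ∑ i, p i = 1) ∧
        IsLeast {y : ℝ | ∃ q : Fin n → ℝ, ((∀ j, 0 ≤ q j) ∧ ∑ j, q j = 1) ∧
          y = ∑ i, ∑ j, p i * A i j * q j} x} v ∧
      IsLeast {x : ℝ | ∃ q : Fin n → ℝ, ((∀ j, 0 ≤ q j) ∧ ∑ j, q j = 1) ∧
        IsGreatest {y : ℝ | ∃ p : Fin m → ℝ, ((∀ i, 0 ≤ p i) ∧ ∑ i, p i = 1) ∧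
          y = ∑ i, ∑ j, p i * A i j * q j} x} v := by
  have : Nonempty (Fin m) := ⟨⟨0, hm⟩⟩
  have : Nonempty (Fin n) := ⟨⟨0, hn⟩⟩
  obtain ⟨p, hp, q, hq, h⟩ := A.exists_saddlePoint_stdSimplex
  refine ⟨∑ i, ∑ j, p i * A i j * q j, ⟨⟨p, hp, ⟨q, hq, rfl⟩, ?_⟩, ?_⟩,
    ⟨⟨q, hq, ⟨p, hp, rfl⟩, ?_⟩, ?_⟩⟩
  · rintro _ ⟨q', hq', rfl⟩
    exact h p hp q' hq'
  · rintro x ⟨p', hp', -, hx⟩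
    exact (hx ⟨q, hq, rfl⟩).trans (h p' hp' q hq)
  · rintro _ ⟨p', hp', rfl⟩
    exact h p' hp' q hq
  · rintro x ⟨q', hq', -, hx⟩
    exact (h p hp q' hq').trans (hx ⟨p, hp, rfl⟩)
end

section
/- Fourier–Motzkin projection as nonnegative combinations: let A ∈ ℝ^{m×n}, b ∈ ℝ^m, and 0 ≤ k ≤ n. Then there exist finitely many vectors y₁, …, y_r ∈ ℝ^m with each y_ℓ ≥ 0 and (y_ℓᵀA)_j = 0 for all j ∈ {1,…,k}, such that the projection { (x_{k+1},…,x_n) ∈ ℝ^{n−k} : there exist (x₁,…,x_k) ∈ ℝ^k with A x ≤ b } equals the solution set { (x_{k+1},…,x_n) : for all ℓ ∈ [r], Σ_{j=k+1}^{n} (y_ℓᵀA)_j x_j ≤ y_ℓᵀ b }. -/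
/-- Finitely many lower bounds, each at most every one of finitely many upper bounds,
can be separated by a point. -/
theorem Finset.exists_between_of_forall_le {α : Type*} [LinearOrder α] [Nonempty α]
    (L U : Finset α) (h : ∀ l ∈ L, ∀ u ∈ U, l ≤ u) :
    ∃ t, (∀ l ∈ L, l ≤ t) ∧ ∀ u ∈ U, t ≤ u := by
  rcases L.eq_empty_or_nonempty with rfl | hL
  · rcases U.eq_empty_or_nonempty with rfl | hU
    · simp
    · exact ⟨U.min' hU, by simp, fun u hu => U.min'_le u hu⟩
  · exact ⟨L.max' hL, fun l hl => L.le_max' l hl, fun u hu => h _ (L.max'_mem hL) u hu⟩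

/-- Solvability of a finite system `c y * t ≤ g y` in one unknown. -/
theorem exists_forall_mul_le {β : Type*} (T : Finset β) (c g : β → ℝ)
    (h0 : ∀ y ∈ T, c y = 0 → 0 ≤ g y)
    (h : ∀ p ∈ T, ∀ q ∈ T, 0 < c p → c q < 0 → 0 ≤ -c q * g p + c p * g q) :
    ∃ t : ℝ, ∀ y ∈ T, c y * t ≤ g y := by
  classical
  obtain ⟨t, hL, hU⟩ := Finset.exists_between_of_forall_le
    ((T.filter (c · < 0)).image fun y => g y / c y)
    ((T.filter (0 < c ·)).image fun y => g y / c y) (by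
      simp only [Finset.mem_image, Finset.mem_filter]
      rintro _ ⟨q, ⟨hq, hcq⟩, rfl⟩ _ ⟨p, ⟨hp, hcp⟩, rfl⟩
      rw [div_le_iff_of_neg hcq, div_mul_eq_mul_div, div_le_iff₀ hcp]
      linarith [h p hp q hq hcp hcq])
  refine ⟨t, fun y hy => ?_⟩
  rcases lt_trichotomy (c y) 0 with hc | hc | hc
  · have := hL _ (Finset.mem_image_of_mem _ (Finset.mem_filter.2 ⟨hy, hc⟩))
    rw [div_le_iff_of_neg hc] at this
    linarith
  · simpa [hc] using h0 y hy hc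
  · have := hU _ (Finset.mem_image_of_mem _ (Finset.mem_filter.2 ⟨hy, hc⟩))
    rw [le_div_iff₀ hc] at this
    linarith

open Matrix in
/-- Elimination of the unknowns in `S` from the system `A x ≤ b` by finitely many nonnegative
combinations of its inequalities. -/
theorem Matrix.exists_finset_eliminating {ι κ : Type*} [Fintype ι] [Fintype κ]
    (A : Matrix ι κ ℝ) (b : ι → ℝ) (S : Finset κ) :
    ∃ T : Finset (ι → ℝ), (∀ y ∈ T, 0 ≤ y) ∧ (∀ y ∈ T, ∀ j ∈ S, y ⬝ᵥ A.col j = 0) ∧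
      ∀ x : κ → ℝ, (∀ y ∈ T, 0 ≤ y ⬝ᵥ (b - A *ᵥ x)) →
        ∃ x' : κ → ℝ, (∀ j ∉ S, x' j = x j) ∧ A *ᵥ x' ≤ b := by
  classical
  induction S using Finset.induction_on with
  | empty =>
    refine ⟨Finset.univ.image fun i => Pi.single i 1, ?_, by simp, fun x hx => ⟨x, by simp, ?_⟩⟩
    · simp [Pi.single_nonneg]
    · intro i
      simpa using hx (Pi.single i 1) (by simp)
  | insert j S _ ih =>
    obtain ⟨T, hT, hS, hx⟩ := ih
    set c : (ι → ℝ) → ℝ := fun y => y ⬝ᵥ A.col j with hc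
    refine ⟨T.filter (c · = 0) ∪ ((T.filter (0 < c ·)) ×ˢ (T.filter (c · < 0))).image
      (fun w => -c w.2 • w.1 + c w.1 • w.2), ?_, ?_, fun x h => ?_⟩
    · simp only [Finset.mem_union, Finset.mem_image, Finset.mem_product, Finset.mem_filter]
      rintro _ (⟨hy, -⟩ | ⟨⟨p, q⟩, ⟨⟨hp, hcp⟩, hq, hcq⟩, rfl⟩)
      · exact hT _ hy
      · exact add_nonneg (smul_nonneg (neg_nonneg.2 hcq.le) (hT _ hp))
          (smul_nonneg hcp.le (hT _ hq))
    · simp only [Finset.mem_union, Finset.mem_image, Finset.mem_product, Finset.mem_filter,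
        Finset.mem_insert]
      rintro _ (⟨hy, hcy⟩ | ⟨⟨p, q⟩, ⟨⟨hp, hcp⟩, hq, hcq⟩, rfl⟩) i (rfl | hi)
      · exact hcy
      · exact hS _ hy _ hi
      · simp only [add_dotProduct, smul_dotProduct, smul_eq_mul, hc]
        ring
      · simp [add_dotProduct, smul_dotProduct, hS _ hp _ hi, hS _ hq _ hi]
    · obtain ⟨t, ht⟩ := exists_forall_mul_le T c (fun y => y ⬝ᵥ (b - A *ᵥ x))
        (fun y hy hcy => h y (Finset.mem_union_left _ (Finset.mem_filter.2 ⟨hy, hcy⟩)))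
        (fun p hp q hq hcp hcq => by
          have := h _ (Finset.mem_union_right _ (Finset.mem_image_of_mem _
            (Finset.mk_mem_product (Finset.mem_filter.2 ⟨hp, hcp⟩)
              (Finset.mem_filter.2 ⟨hq, hcq⟩))))
          simpa only [add_dotProduct, smul_dotProduct, smul_eq_mul] using this)
      obtain ⟨x', hx', hA⟩ := hx (x + t • Pi.single j 1) (fun y hy => by
        have := ht y hy
        simp only [mulVec_add, mulVec_smul, mulVec_single_one, dotProduct_sub, dotProduct_add,
          dotProduct_smul, smul_eq_mul, hc] at this ⊢
        linarith)
      refine ⟨x', fun i hi => ?_, hA⟩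
      rw [Finset.mem_insert, not_or] at hi
      simp [hx' i hi.2, hi.1]


/-- Fourier–Motzkin projection: the projection of the solution set of `A x ≤ b`
onto the last `n − k` coordinates is the solution set of finitely many
nonnegative combinations `yₗᵀ A x ≤ yₗᵀ b` of the original inequalities, each of
which has zero coefficients on the first `k` unknowns. -/
theorem fourier_motzkin_projection (m n k : ℕ) (hk : k ≤ n)
    (A : Matrix (Fin m) (Fin n) ℝ) (b : Fin m → ℝ) :
    ∃ (r : ℕ) (Y : Fin r → Fin m → ℝ),
      (∀ l i, 0 ≤ Y l i) ∧
      (∀ l (j : Fin n), (j : ℕ) < k → ∑ i, Y l i * A i j = 0) ∧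
      (∀ z : Fin (n - k) → ℝ,
        (∃ x : Fin n → ℝ,
            (∀ j : Fin (n - k), x ⟨k + j.1, by have := j.isLt; omega⟩ = z j) ∧
            ∀ i, ∑ j, A i j * x j ≤ b i) ↔
        (∀ l, ∑ j : Fin (n - k),
            (∑ i, Y l i * A i ⟨k + j.1, by have := j.isLt; omega⟩) * z j ≤
            ∑ i, Y l i * b i)) := by
  classical
  obtain ⟨T, hT, hS, hx⟩ := A.exists_finset_eliminating b (Finset.univ.filter fun j => (j : ℕ) < k)
  let e : Fin (n - k) → Fin n := fun j => ⟨k + j.1, by have := j.isLt; omega⟩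
  have he : Function.Injective e := fun i j h => by
    simpa [e, Fin.ext_iff] using h
  have hrange : ∀ j : Fin n, j ∉ Set.range e → (j : ℕ) < k := fun j hj => by
    by_contra! hkj
    exact hj ⟨⟨j - k, by omega⟩, Fin.ext (by simp [e]; omega)⟩
  have hsum : ∀ y ∈ T, ∀ x : Fin n → ℝ,
      ∑ j, (∑ i, y i * A i (e j)) * x (e j) = dotProduct y (A.mulVec x) := fun y hy x => by
    rw [Matrix.dotProduct_mulVec]
    refine Fintype.sum_of_injective e he _ _ (fun j hj => ?_) fun j => rfl
    have h0 : A.vecMul y j = 0 := hS y hy j (by simpa using hrange j hj)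
    rw [h0, zero_mul]
  refine ⟨T.card, fun l => T.equivFin.symm l, fun l => hT _ (T.equivFin.symm l).2,
    fun l j hj => hS _ (T.equivFin.symm l).2 j (by simpa using hj), fun z => ⟨?_, fun h => ?_⟩⟩
  · rintro ⟨x, hz, hA⟩ l
    have hl := (T.equivFin.symm l).2
    simp only [← hz]
    exact (hsum _ hl x).trans_le (dotProduct_le_dotProduct_of_nonneg_left hA (hT _ hl))
  · obtain ⟨x, hxz, hA⟩ := hx (Function.extend e z 0) fun y hy => by
      have := h (T.equivFin ⟨y, hy⟩)
      rw [dotProduct_sub, sub_nonneg, ← hsum y hy]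
      simpa [he.extend_apply, dotProduct] using this
    refine ⟨x, fun j => ?_, hA⟩
    rw [hxz _ (by simp), ← he.extend_apply z 0 j]
end

section
/- Key Farkas-type step: let A ∈ ℝ^{m×n} and let v* ∈ ℝ be the smallest element of the set { v ∈ ℝ : there exists q ∈ ℝ^n with q ≥ 0, 1ᵀq = 1 and A q ≤ v·1 }. Then there exists p* ∈ ℝ^m with p* ≥ 0, 1ᵀp* = 1 and (p*)ᵀA ≥ v*·1ᵀ (componentwise). -/
/-- Farkas-type step: if `v*` is the smallest value securable by player 2,
then player 1 has a mixed strategy guaranteeing at least `v*`. -/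
theorem farkas_step (m n : ℕ) (hm : 0 < m) (hn : 0 < n)
    (A : Matrix (Fin m) (Fin n) ℝ) (v' : ℝ)
    (hv' : IsLeast {v : ℝ | ∃ q : Fin n → ℝ, (∀ j, 0 ≤ q j) ∧ (∑ j, q j = 1) ∧
        ∀ i, ∑ j, A i j * q j ≤ v} v') :
    ∃ p : Fin m → ℝ, (∀ i, 0 ≤ p i) ∧ (∑ i, p i = 1) ∧
      ∀ j, v' ≤ ∑ i, p i * A i j := by
  have : Nonempty (Fin m) := ⟨⟨0, hm⟩⟩
  -- Separate the open orthant below `v'` from the set of payoff vectors of player 2.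
  let s : Set (Fin m → ℝ) := Set.pi Set.univ fun _ => Set.Iio v'
  let t : Set (Fin m → ℝ) := A.mulVecLin '' stdSimplex ℝ (Fin n)
  have hs : Convex ℝ s := convex_pi fun _ _ => convex_Iio v'
  have hso : IsOpen s := isOpen_set_pi Set.finite_univ fun _ _ => isOpen_Iio
  have ht : Convex ℝ t := (convex_stdSimplex ℝ (Fin n)).linear_image _
  have hst : Disjoint s t := by
    rw [Set.disjoint_left]
    rintro _ hx ⟨q, hq, rfl⟩
    obtain ⟨i₀, hi₀⟩ := Finite.exists_max (A.mulVecLin q)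
    have h := hv'.2 ⟨q, hq.1, hq.2, hi₀⟩
    exact absurd (hx i₀ trivial) (not_lt.mpr h)
  obtain ⟨f, u, hfs, hft⟩ := geometric_hahn_banach_open hs hso ht hst
  let c : Fin m → ℝ := fun i => f (Pi.single i 1)
  have hf (x : Fin m → ℝ) : f x = ∑ i, x i * c i := by
    refine ((f : (Fin m → ℝ) →ₗ[ℝ] ℝ).pi_apply_eq_sum_univ x).trans
      (Finset.sum_congr rfl fun i _ => congrArg (fun y => x i * f y) ?_)
    ext j
    simp [Pi.single_apply, eq_comm]
  have hbelow (ε : ℝ) (hε : 0 < ε) : f (fun _ => v' - ε) < u :=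
    hfs _ fun _ _ => sub_lt_self v' hε
  have hc (i : Fin m) : 0 ≤ c i := by
    by_contra! hi
    have h1 := hbelow 1 one_pos
    set x : Fin m → ℝ := fun _ => v' - 1 with hx
    have hK : 0 ≤ (u - f x) / -c i := div_nonneg (by linarith) (by linarith)
    have h := hfs (x - ((u - f x) / -c i) • Pi.single i 1) fun k _ => by
      have : 0 ≤ ((u - f x) / -c i) * (Pi.single i 1 : Fin m → ℝ) k :=
        mul_nonneg hK (by by_cases hk : k = i <;> simp [hk])
      simp only [Set.mem_Iio, Pi.sub_apply, Pi.smul_apply, smul_eq_mul, hx] at this ⊢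
      linarith
    rw [map_sub, map_smul, smul_eq_mul] at h
    change f x - (u - f x) / -c i * c i < u at h
    rw [div_neg, neg_mul, div_mul_cancel₀ _ hi.ne] at h
    linarith
  have hcol (j : Fin n) : u ≤ ∑ i, A i j * c i := by
    have h := hft _ ⟨Pi.single j 1, single_mem_stdSimplex ℝ j, rfl⟩
    rw [hf] at h
    simpa using h
  have hpos : 0 < ∑ i, c i := by
    refine (Finset.sum_nonneg fun i _ => hc i).lt_of_ne' fun h0 => ?_
    have hzero := (Finset.sum_eq_zero_iff_of_nonneg fun i _ => hc i).mp h0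
    have h1 := hbelow 1 one_pos
    have h2 := hcol ⟨0, hn⟩
    rw [hf, Finset.sum_eq_zero fun i hi => by rw [hzero i hi, mul_zero]] at h1
    rw [Finset.sum_eq_zero fun i hi => by rw [hzero i hi, mul_zero]] at h2
    linarith
  have hu : v' ≤ u / ∑ i, c i := by
    refine le_of_forall_pos_le_add fun ε hε => ?_
    have h := hbelow ε hε
    rw [hf, ← Finset.mul_sum, ← lt_div_iff₀ hpos] at h
    linarith
  refine ⟨fun i => c i / ∑ k, c k, fun i => div_nonneg (hc i) hpos.le, ?_, fun j => ?_⟩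
  · rw [← Finset.sum_div, div_self hpos.ne']
  · calc v' ≤ u / ∑ i, c i := hu
      _ ≤ (∑ i, A i j * c i) / ∑ i, c i := by gcongr; exact hcol j
      _ = ∑ i, c i / (∑ k, c k) * A i j := by
        rw [Finset.sum_div]
        exact Finset.sum_congr rfl fun i _ => by ring
end
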